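/- (Unique existence.) For generic input N_1,…,N_{n−2}, W_1,…,W_{n−2} and τJ_0,…,τJ_n for J = 1,2,3 (i.e., all these values are nonzero and the values τ0_1,…,τ0_{n−1} determined by equations ⟨2,1⟩–⟨2,n−1⟩ are nonzero), there exists a unique solution of the full system of bilinear equations ⟨J,i⟩ (1 ≤ J ≤ 4, 0 ≤ i ≤ n) in the remaining unknowns S_1,…,S_{n−2}, E_1,…,E_{n−2}, τ0_0,…,τ0_n and τ4_0,…,τ4_n. -/

import Mathlib

/-- The `D^(1)_n` bilinear equation `⟨J,i⟩` on the tau functions. -/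
def BE {F : Type*} [Field F] (n : ℕ)
    (lam lamb kap kapb S W N E t0 t1 t2 t3 t4 : ℕ → F)
    (α β : F) (J i : ℕ) : Prop :=
  if J = 1 then
    if i = 0 then kapb 1 * N 1 * t4 1 - lamb 1 * E 1 * t2 1 = α * t0 0 * t1 0
    else if i = 1 then kap 1 * N 1 * t4 0 - lam 1 * E 1 * t2 0 = α * t0 1 * t1 1
    else if i = n - 1 then
      kap (n - 1) * kap n * E (n - 2) * t2 n - lam (n - 1) * lam n * N (n - 2) * t4 n
        = α * t0 (n - 1) * t1 n
    else if i = n then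
      kap (n - 1) * E (n - 2) * t2 (n - 1) - lam (n - 1) * N (n - 2) * t4 (n - 1)
        = α * t0 n * t1 (n - 1)
    else kap i * E (i - 1) * N i - lam i * N (i - 1) * E i = α * t0 i * t1 i
  else if J = 2 then
    if i = 0 then kap 1 * N 1 * t3 1 + lamb 1 * W 1 * t1 1 = β * t0 0 * t2 0
    else if i = 1 then kapb 1 * N 1 * t3 0 + lam 1 * W 1 * t1 0 = β * t0 1 * t2 1
    else if i = n - 1 then
      kap n * kapb (n - 1) * W (n - 2) * t1 (n - 1) + lam (n - 1) * N (n - 2) * t3 (n - 1)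
        = β * t0 (n - 1) * t2 (n - 1)
    else if i = n then
      kapb (n - 1) * W (n - 2) * t1 n + lam (n - 1) * lam n * N (n - 2) * t3 n
        = β * t0 n * t2 n
    else kapb i * W (i - 1) * N i + lam i * N (i - 1) * W i = β * t0 i * t2 i
  else if J = 3 then
    if i = 0 then kap 1 * S 1 * t2 1 - lam 1 * W 1 * t4 1 = α * t0 0 * t3 0
    else if i = 1 then kapb 1 * S 1 * t2 0 - lamb 1 * W 1 * t4 0 = α * t0 1 * t3 1
    else if i = n - 1 then
      kapb (n - 1) * W (n - 2) * t4 n - lamb (n - 1) * S (n - 2) * t2 n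
        = α * t0 (n - 1) * t3 n
    else if i = n then
      kap n * kapb (n - 1) * W (n - 2) * t4 (n - 1) - lam n * lamb (n - 1) * S (n - 2) * t2 (n - 1)
        = α * t0 n * t3 (n - 1)
    else kapb i * W (i - 1) * S i - lamb i * S (i - 1) * W i = α * t0 i * t3 i
  else if J = 4 then
    if i = 0 then kapb 1 * S 1 * t1 1 + lam 1 * E 1 * t3 1 = β * t0 0 * t4 0
    else if i = 1 then kap 1 * S 1 * t1 0 + lamb 1 * E 1 * t3 0 = β * t0 1 * t4 1
    else if i = n - 1 then
      kap (n - 1) * E (n - 2) * t3 (n - 1) + lam n * lamb (n - 1) * S (n - 2) * t1 (n - 1)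
        = β * t0 (n - 1) * t4 (n - 1)
    else if i = n then
      kap (n - 1) * kap n * E (n - 2) * t3 n + lamb (n - 1) * S (n - 2) * t1 n
        = β * t0 n * t4 n
    else kap i * E (i - 1) * S i + lamb i * S (i - 1) * E i = β * t0 i * t4 i
  else True

/-- The solution, started at `x`, of the first-order linear recurrence
`a j * u (j + 1) = b j * u j + c j`. -/
def linRec {F : Type*} [Field F] (a b c : ℕ → F) (x : F) : ℕ → F
  | 0 => x
  | j + 1 => (b j * linRec a b c x j + c j) / a j

theorem linRec_succ {F : Type*} [Field F] (a b c : ℕ → F) (x : F) {j : ℕ} (ha : a j ≠ 0) :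
    a j * linRec a b c x (j + 1) = b j * linRec a b c x j + c j := by
  rw [linRec, mul_div_cancel₀ _ ha]

theorem eq_linRec {F : Type*} [Field F] {a b c u : ℕ → F} {M : ℕ} (ha : ∀ j < M, a j ≠ 0)
    (hu : ∀ j < M, a j * u (j + 1) = b j * u j + c j) {j : ℕ} (hj : j ≤ M) :
    u j = linRec a b c (u 0) j := by
  induction j with
  | zero => rfl
  | succ j ih =>
    apply mul_left_cancel₀ (ha j hj)
    rw [linRec_succ a b c _ (ha j hj), hu j hj, ← ih (by omega)]

/-- `linRec` is affine in its initial value. -/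
theorem prod_mul_linRec {F : Type*} [Field F] {a b c : ℕ → F} (x : F) {M : ℕ}
    (ha : ∀ j < M, a j ≠ 0) :
    (∏ j ∈ Finset.range M, a j) * linRec a b c x M
      = (∏ j ∈ Finset.range M, a j) * linRec a b c 0 M + (∏ j ∈ Finset.range M, b j) * x := by
  induction M with
  | zero => simp [linRec]
  | succ M ih =>
    have h := ih fun j hj => ha j (by omega)
    have h1 := linRec_succ a b c x (ha M (by omega))
    have h0 := linRec_succ a b c 0 (ha M (by omega))
    rw [Finset.prod_range_succ, Finset.prod_range_succ]
    linear_combination (∏ j ∈ Finset.range M, a j) * (h1 - h0) + b M * h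

/-- Multiplying the products over the shifted ranges `1, …, M` and `0, …, M - 1` by the missing
end terms gives the same result. -/
theorem prod_range_shift_mul {F : Type*} [Field F] (f : ℕ → F) (M : ℕ) :
    (∏ j ∈ Finset.range M, f (j + 1)) * f 0 = (∏ j ∈ Finset.range M, f j) * f M := by
  rw [← Finset.prod_range_succ', Finset.prod_range_succ]

theorem prod_Icc_one_add_two {F : Type*} [Field F] (f : ℕ → F) (M : ℕ) :
    ∏ i ∈ Finset.Icc 1 (M + 2), f i
      = f 1 * (∏ j ∈ Finset.range M, f (j + 2)) * f (M + 2) := by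
  have h := Finset.prod_Ico_eq_prod_range f 1 (M + 3)
  rw [show Finset.Icc 1 (M + 2) = Finset.Ico 1 (M + 3) from rfl, h,
    show M + 3 - 1 = M + 1 + 1 from rfl, Finset.prod_range_succ, Finset.prod_range_succ']
  simp only [add_comm 1, add_assoc, Nat.reduceAdd, zero_add]
  ring

/-- At an end of the diagram, the equations `⟨1,·⟩`, `⟨2,·⟩` and `⟨3,·⟩` imply a relation
between the four neighbouring variables. -/
theorem end_relation {F : Type*} [Field F] {p q r u N W S E α β x y t1 t2 t3 t4 : F}
    (h2 : t2 ≠ 0) (e1 : p * N * t4 - q * E * t2 = α * x * t1)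
    (e2 : p * N * t3 + u * W * t1 = β * y * t2)
    (e3 : r * S * t2 - u * W * t4 = α * x * t3) :
    r * p * N * S - q * u * W * E = α * β * x * y := by
  apply mul_left_cancel₀ h2
  linear_combination u * W * e1 + p * N * e3 + α * x * e2

theorem end_third {F : Type*} [Field F] {p q r u N W S E α β x y t1 t2 t3 t4 : F}
    (hp : p ≠ 0) (hN : N ≠ 0) (e1 : p * N * t4 - q * E * t2 = α * x * t1)
    (e2 : p * N * t3 + u * W * t1 = β * y * t2)
    (h : r * p * N * S - q * u * W * E = α * β * x * y) :
    r * S * t2 - u * W * t4 = α * x * t3 := by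
  apply mul_left_cancel₀ (mul_ne_zero hp hN)
  linear_combination t2 * h - u * W * e1 - α * x * e2

theorem end_fourth {F : Type*} [Field F] {p q r u N W S E α β x y t1 t2 t3 t4 : F}
    (h2 : t2 ≠ 0) (e1 : p * N * t4 - q * E * t2 = α * x * t1)
    (e2 : p * N * t3 + u * W * t1 = β * y * t2)
    (e3 : r * S * t2 - u * W * t4 = α * x * t3) :
    r * S * t1 + q * E * t3 = β * y * t4 := by
  apply mul_left_cancel₀ h2
  linear_combination t1 * e3 - t3 * e1 + t4 * e2

/-- The bilinear equations for `n = m + 4` with the redundant ones at the two ends of the diagram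
replaced by one relation at each end. -/
structure ReducedSystem {F : Type*} [Field F] (m : ℕ)
    (lam lamb kap kapb S W N E t0 t1 t2 t3 t4 : ℕ → F) (α β : F) : Prop where
  tau0_zero : kap 1 * N 1 * t3 1 + lamb 1 * W 1 * t1 1 = β * t0 0 * t2 0
  tau0_one : kapb 1 * N 1 * t3 0 + lam 1 * W 1 * t1 0 = β * t0 1 * t2 1
  tau0_mid : ∀ j < m + 1, kapb (j + 2) * W (j + 1) * N (j + 2) + lam (j + 2) * N (j + 1) * W (j + 2)
    = β * t0 (j + 2) * t2 (j + 2)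
  tau0_penult : kap (m + 4) * kapb (m + 3) * W (m + 2) * t1 (m + 3)
    + lam (m + 3) * N (m + 2) * t3 (m + 3) = β * t0 (m + 3) * t2 (m + 3)
  tau0_last : kapb (m + 3) * W (m + 2) * t1 (m + 4)
    + lam (m + 3) * lam (m + 4) * N (m + 2) * t3 (m + 4) = β * t0 (m + 4) * t2 (m + 4)
  tau4_one : kapb 1 * N 1 * t4 1 - lamb 1 * E 1 * t2 1 = α * t0 0 * t1 0
  tau4_zero : kap 1 * N 1 * t4 0 - lam 1 * E 1 * t2 0 = α * t0 1 * t1 1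
  tau4_last : kap (m + 3) * kap (m + 4) * E (m + 2) * t2 (m + 4)
    - lam (m + 3) * lam (m + 4) * N (m + 2) * t4 (m + 4) = α * t0 (m + 3) * t1 (m + 4)
  tau4_penult : kap (m + 3) * E (m + 2) * t2 (m + 3) - lam (m + 3) * N (m + 2) * t4 (m + 3)
    = α * t0 (m + 4) * t1 (m + 3)
  tau4_mid : ∀ j < m + 1, kap (j + 2) * E (j + 1) * S (j + 2) + lamb (j + 2) * S (j + 1) * E (j + 2)
    = β * t0 (j + 2) * t4 (j + 2)
  east : ∀ j < m + 1, lam (j + 2) * N (j + 1) * E (j + 2)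
    = kap (j + 2) * N (j + 2) * E (j + 1) + -(α * t0 (j + 2) * t1 (j + 2))
  south : ∀ j < m + 1, kapb (j + 2) * W (j + 1) * S (j + 2)
    = lamb (j + 2) * W (j + 2) * S (j + 1) + α * t0 (j + 2) * t3 (j + 2)
  first_end : kap 1 * kapb 1 * N 1 * S 1 - lamb 1 * lam 1 * W 1 * E 1 = α * β * t0 0 * t0 1
  last_end : kap (m + 3) * kap (m + 4) * kapb (m + 3) * W (m + 2) * E (m + 2)
    - lam (m + 3) * lam (m + 4) * lamb (m + 3) * N (m + 2) * S (m + 2)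
      = α * β * t0 (m + 3) * t0 (m + 4)

section ReducedSystem

variable {F : Type*} [Field F] {m : ℕ} {lam lamb kap kapb S W N E t0 t1 t2 t3 t4 : ℕ → F} {α β : F}

theorem ReducedSystem.of_BE (ht2 : ∀ i ≤ m + 4, t2 i ≠ 0)
    (h : ∀ J i, 1 ≤ J → J ≤ 4 → i ≤ m + 4 →
      BE (m + 4) lam lamb kap kapb S W N E t0 t1 t2 t3 t4 α β J i) :
    ReducedSystem m lam lamb kap kapb S W N E t0 t1 t2 t3 t4 α β := by
  have mid : ∀ J j, 1 ≤ J → J ≤ 4 → j < m + 1 →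
      BE (m + 4) lam lamb kap kapb S W N E t0 t1 t2 t3 t4 α β J (j + 2) :=
    fun J j h1 h4 hj => h J (j + 2) h1 h4 (by omega)
  have e10 := h 1 0 (by omega) (by omega) (by omega)
  have e11 := h 1 1 (by omega) (by omega) (by omega)
  have e1p := h 1 (m + 3) (by omega) (by omega) (by omega)
  have e1l := h 1 (m + 4) (by omega) (by omega) (by omega)
  have e20 := h 2 0 (by omega) (by omega) (by omega)
  have e21 := h 2 1 (by omega) (by omega) (by omega)
  have e2p := h 2 (m + 3) (by omega) (by omega) (by omega)
  have e2l := h 2 (m + 4) (by omega) (by omega) (by omega)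
  have e30 := h 3 0 (by omega) (by omega) (by omega)
  have e3p := h 3 (m + 3) (by omega) (by omega) (by omega)
  simp [BE] at e10 e11 e1p e1l e20 e21 e2p e2l e30 e3p
  refine ⟨e20, e21, fun j hj => ?_, e2p, e2l, e10, e11, e1p, e1l, fun j hj => ?_,
    fun j hj => ?_, fun j hj => ?_, end_relation (ht2 1 (by omega)) e10 e21 e30, ?_⟩
  · simpa [BE, show j ≠ m + 1 by omega, show j ≠ m + 2 by omega] using
      mid 2 j (by omega) (by omega) hj
  · simpa [BE, show j ≠ m + 1 by omega, show j ≠ m + 2 by omega] using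
      mid 4 j (by omega) (by omega) hj
  · have := mid 1 j (by omega) (by omega) hj
    simp [BE, show j ≠ m + 1 by omega, show j ≠ m + 2 by omega] at this
    linear_combination -this
  · have := mid 3 j (by omega) (by omega) hj
    simp [BE, show j ≠ m + 1 by omega, show j ≠ m + 2 by omega] at this
    linear_combination this
  · apply mul_left_cancel₀ (ht2 (m + 4) le_rfl)
    linear_combination kapb (m + 3) * W (m + 2) * e1p
      + lam (m + 3) * lam (m + 4) * N (m + 2) * e3p + α * t0 (m + 3) * e2l

theorem ReducedSystem.toBE
    (h : ReducedSystem m lam lamb kap kapb S W N E t0 t1 t2 t3 t4 α β)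
    (hlam : ∀ i, 1 ≤ i → i ≤ m + 4 → lam i ≠ 0)
    (hkap : ∀ i, 1 ≤ i → i ≤ m + 4 → kap i ≠ 0)
    (hkapb : ∀ i, 1 ≤ i → i ≤ m + 3 → kapb i ≠ 0)
    (hN : ∀ i, 1 ≤ i → i ≤ m + 2 → N i ≠ 0) (ht2 : ∀ i ≤ m + 4, t2 i ≠ 0)
    (J i : ℕ) (hJ : 1 ≤ J) (hJ' : J ≤ 4) (hi : i ≤ m + 4) :
    BE (m + 4) lam lamb kap kapb S W N E t0 t1 t2 t3 t4 α β J i := by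
  have e30 := end_third (hkapb 1 le_rfl (by omega)) (hN 1 le_rfl (by omega))
    h.tau4_one h.tau0_one h.first_end
  have e31 : kapb 1 * S 1 * t2 0 - lamb 1 * W 1 * t4 0 = α * t0 1 * t3 1 :=
    end_third (hkap 1 le_rfl (by omega)) (hN 1 le_rfl (by omega))
      h.tau4_zero h.tau0_zero (by linear_combination h.first_end)
  have e41 := end_fourth (ht2 1 (by omega)) h.tau4_one h.tau0_one e30
  have e40 := end_fourth (ht2 0 (by omega)) h.tau4_zero h.tau0_zero e31
  have e3p : kapb (m + 3) * W (m + 2) * t4 (m + 4) - lamb (m + 3) * S (m + 2) * t2 (m + 4)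
      = α * t0 (m + 3) * t3 (m + 4) := by
    have := end_third (r := -lamb (m + 3)) (u := -kapb (m + 3)) (q := -(kap (m + 3) * kap (m + 4)))
      (p := -(lam (m + 3) * lam (m + 4))) (S := S (m + 2)) (W := W (m + 2)) (E := E (m + 2))
      (N := N (m + 2)) (x := t0 (m + 3)) (t1 := t1 (m + 4)) (t2 := t2 (m + 4)) (t3 := t3 (m + 4))
      (t4 := t4 (m + 4)) (α := α) (β := -β) (y := t0 (m + 4))
      (neg_ne_zero.2 (mul_ne_zero (hlam _ (by omega) (by omega)) (hlam _ (by omega) (by omega))))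
      (hN _ (by omega) le_rfl) (by linear_combination h.tau4_last)
      (by linear_combination -h.tau0_last) (by linear_combination -h.last_end)
    linear_combination this
  have e3l : kap (m + 4) * kapb (m + 3) * W (m + 2) * t4 (m + 3)
      - lam (m + 4) * lamb (m + 3) * S (m + 2) * t2 (m + 3) = α * t0 (m + 4) * t3 (m + 3) := by
    have := end_third (r := -(lam (m + 4) * lamb (m + 3))) (u := -(kap (m + 4) * kapb (m + 3)))
      (q := -kap (m + 3)) (p := -lam (m + 3)) (S := S (m + 2)) (W := W (m + 2)) (E := E (m + 2))
      (N := N (m + 2)) (x := t0 (m + 4)) (t1 := t1 (m + 3)) (t2 := t2 (m + 3)) (t3 := t3 (m + 3))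
      (t4 := t4 (m + 3)) (α := α) (β := -β) (y := t0 (m + 3))
      (neg_ne_zero.2 (hlam _ (by omega) (by omega)))
      (hN _ (by omega) le_rfl) (by linear_combination h.tau4_penult)
      (by linear_combination -h.tau0_penult) (by linear_combination -h.last_end)
    linear_combination this
  have e4l : kap (m + 3) * kap (m + 4) * E (m + 2) * t3 (m + 4)
      + lamb (m + 3) * S (m + 2) * t1 (m + 4) = β * t0 (m + 4) * t4 (m + 4) := by
    apply mul_left_cancel₀ (ht2 (m + 4) le_rfl)
    linear_combination t3 (m + 4) * h.tau4_last - t1 (m + 4) * e3p + t4 (m + 4) * h.tau0_last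
  have e4p : kap (m + 3) * E (m + 2) * t3 (m + 3)
      + lam (m + 4) * lamb (m + 3) * S (m + 2) * t1 (m + 3) = β * t0 (m + 3) * t4 (m + 3) := by
    apply mul_left_cancel₀ (ht2 (m + 3) (by omega))
    linear_combination t3 (m + 3) * h.tau4_penult - t1 (m + 3) * e3l + t4 (m + 3) * h.tau0_penult
  obtain rfl | rfl | rfl | rfl | ⟨j, hj, rfl⟩ :
      i = 0 ∨ i = 1 ∨ i = m + 3 ∨ i = m + 4 ∨ ∃ j < m + 1, i = j + 2 := by
    by_cases h2 : 2 ≤ i ∧ i < m + 3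
    · exact .inr (.inr (.inr (.inr ⟨i - 2, by omega, by omega⟩)))
    · omega
  · interval_cases J <;> simp only [BE] <;> simp
    exacts [h.tau4_one, h.tau0_zero, e30, e40]
  · interval_cases J <;> simp only [BE] <;> simp
    exacts [h.tau4_zero, h.tau0_one, e31, e41]
  · interval_cases J <;> simp only [BE] <;> simp
    exacts [h.tau4_last, h.tau0_penult, e3p, e4p]
  · interval_cases J <;> simp only [BE] <;> simp
    exacts [h.tau4_penult, h.tau0_last, e3l, e4l]
  · interval_cases J <;> simp only [BE] <;>
      simp [show j ≠ m + 1 by omega, show j ≠ m + 2 by omega]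
    exacts [by linear_combination -h.east j hj, h.tau0_mid j hj,
      by linear_combination h.south j hj, h.tau4_mid j hj]

end ReducedSystem

/-- The function with prescribed values at `0`, `1`, `m + 3`, `m + 4`, and given by `f` elsewhere. -/
def withEnds {F : Type*} (m : ℕ) (a b c d : F) (f : ℕ → F) (i : ℕ) : F :=
  if i = 0 then a else if i = 1 then b else if i = m + 3 then c else if i = m + 4 then d else f i

theorem withEnds_zero {F : Type*} {m : ℕ} (a b c d : F) (f : ℕ → F) : withEnds m a b c d f 0 = a := rfl

theorem withEnds_one {F : Type*} {m : ℕ} (a b c d : F) (f : ℕ → F) : withEnds m a b c d f 1 = b := rfl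

theorem withEnds_penult {F : Type*} {m : ℕ} (a b c d : F) (f : ℕ → F) : withEnds m a b c d f (m + 3) = c := by
  simp [withEnds]

theorem withEnds_last {F : Type*} {m : ℕ} (a b c d : F) (f : ℕ → F) : withEnds m a b c d f (m + 4) = d := by
  simp [withEnds]

theorem withEnds_mid {F : Type*} {m : ℕ} (a b c d : F) (f : ℕ → F) {j : ℕ} (hj : j < m + 1) :
    withEnds m a b c d f (j + 2) = f (j + 2) := by
  simp [withEnds, show j ≠ m + 1 by omega, show j ≠ m + 2 by omega]

/-- Two functions agree on `0, …, m + 4` if they agree at the ends and in the middle. -/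
theorem eq_of_ends {F : Type*} {m : ℕ} {u v : ℕ → F} (h0 : u 0 = v 0) (h1 : u 1 = v 1) (hp : u (m + 3) = v (m + 3))
    (hl : u (m + 4) = v (m + 4)) (hm : ∀ j < m + 1, u (j + 2) = v (j + 2)) (i : ℕ)
    (hi : i ≤ m + 4) : u i = v i := by
  obtain rfl | rfl | rfl | rfl | h2 :
    i = 0 ∨ i = 1 ∨ i = m + 3 ∨ i = m + 4 ∨ (2 ≤ i ∧ i < m + 3) := by omega
  · exact h0
  · exact h1
  · exact hp
  · exact hl
  · obtain ⟨j, rfl⟩ := Nat.exists_eq_add_of_le' h2.1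
    exact hm j (by omega)

/-- Two linear recurrences coupled linearly at both ends have a unique pair of initial values
as soon as the determinant of the resulting `2 × 2` system does not vanish. -/
theorem exists_unique_linRec_initial {F : Type*} [Field F] {a b c a' b' c' : ℕ → F} {M : ℕ}
    {p q r A B d : F} (ha : ∀ j < M, a j ≠ 0) (ha' : ∀ j < M, a' j ≠ 0)
    (hdet : A * (∏ j ∈ Finset.range M, b j) * (∏ j ∈ Finset.range M, a' j) * p
      - B * (∏ j ∈ Finset.range M, a j) * (∏ j ∈ Finset.range M, b' j) * q ≠ 0) :
    ∃ x₀ y₀, ∀ x y, (p * y - q * x = r ∧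
      A * linRec a b c x M - B * linRec a' b' c' y M = d) ↔ x = x₀ ∧ y = y₀ := by
  have hP : (∏ j ∈ Finset.range M, a j) ≠ 0 :=
    Finset.prod_ne_zero_iff.2 fun j hj => ha j (Finset.mem_range.1 hj)
  have hP' : (∏ j ∈ Finset.range M, a' j) ≠ 0 :=
    Finset.prod_ne_zero_iff.2 fun j hj => ha' j (Finset.mem_range.1 hj)
  have hx := fun x => prod_mul_linRec (b := b) (c := c) x ha
  have hy := fun y => prod_mul_linRec (b := b') (c := c') y ha'
  generalize (∏ j ∈ Finset.range M, a j) = P at *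
  generalize (∏ j ∈ Finset.range M, a' j) = P' at *
  generalize (∏ j ∈ Finset.range M, b j) = Q at *
  generalize (∏ j ∈ Finset.range M, b' j) = Q' at *
  generalize linRec a b c 0 M = X at *
  generalize linRec a' b' c' 0 M = Y at *
  have key : ∀ x y, A * linRec a b c x M - B * linRec a' b' c' y M = d ↔
      A * P' * Q * x - B * P * Q' * y = P * P' * (d - A * X + B * Y) := fun x y => by
    constructor
    · intro h
      linear_combination P * P' * h - A * P' * hx x + B * P * hy y
    · intro h
      apply mul_left_cancel₀ (mul_ne_zero hP hP')
      linear_combination h + A * P' * hx x - B * P * hy y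
  generalize P * P' * (d - A * X + B * Y) = D at key
  refine ⟨(p * D + B * P * Q' * r) / (A * Q * P' * p - B * P * Q' * q),
    (q * D + A * P' * Q * r) / (A * Q * P' * p - B * P * Q' * q), fun x y => ?_⟩
  rw [key, eq_div_iff hdet, eq_div_iff hdet]
  constructor
  · rintro ⟨h1, h2⟩
    constructor
    · linear_combination p * h2 + B * P * Q' * h1
    · linear_combination q * h2 + A * P' * Q * h1
  · rintro ⟨h1, h2⟩
    constructor <;> apply mul_left_cancel₀ hdet
    · linear_combination p * h2 - q * h1
    · linear_combination A * P' * Q * h1 - B * P * Q' * h2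

theorem stmt5 {F : Type*} [Field F] (n : ℕ) (hn : 4 ≤ n)
    (lam lamb kap kapb : ℕ → F) (α β : F)
    (hlam : ∀ i, 1 ≤ i → i ≤ n → lam i ≠ 0)
    (hlamb : ∀ i, 1 ≤ i → i ≤ n - 1 → lamb i ≠ 0)
    (hkap : ∀ i, 1 ≤ i → i ≤ n → kap i ≠ 0)
    (hkapb : ∀ i, 1 ≤ i → i ≤ n - 1 → kapb i ≠ 0)
    (l k : F)
    (hl : l = (∏ i ∈ Finset.Icc 1 n, lam i) * ∏ i ∈ Finset.Icc 1 (n - 1), lamb i)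
    (hk : k = (∏ i ∈ Finset.Icc 1 n, kap i) * ∏ i ∈ Finset.Icc 1 (n - 1), kapb i)
    (hlk : l * k * (l - k) ≠ 0)
    (hα : α ≠ 0) (hβ : β ≠ 0)
    (W N t1 t2 t3 : ℕ → F)
    (hW : ∀ i, 1 ≤ i → i ≤ n - 2 → W i ≠ 0)
    (hN : ∀ i, 1 ≤ i → i ≤ n - 2 → N i ≠ 0)
    (ht1 : ∀ i ≤ n, t1 i ≠ 0) (ht2 : ∀ i ≤ n, t2 i ≠ 0) (ht3 : ∀ i ≤ n, t3 i ≠ 0)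
    -- genericity: the values τ⁰_1,…,τ⁰_{n-1} determined by ⟨2,1⟩–⟨2,n-1⟩ are nonzero
    (hg1 : kapb 1 * N 1 * t3 0 + lam 1 * W 1 * t1 0 ≠ 0)
    (hgi : ∀ i, 2 ≤ i → i ≤ n - 2 → kapb i * W (i - 1) * N i + lam i * N (i - 1) * W i ≠ 0)
    (hgn : kap n * kapb (n - 1) * W (n - 2) * t1 (n - 1) + lam (n - 1) * N (n - 2) * t3 (n - 1) ≠ 0) :
    ∃ S E t0 t4 : ℕ → F,
      (∀ J i, 1 ≤ J → J ≤ 4 → i ≤ n →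
        BE n lam lamb kap kapb S W N E t0 t1 t2 t3 t4 α β J i) ∧
      ∀ S' E' t0' t4' : ℕ → F,
        (∀ J i, 1 ≤ J → J ≤ 4 → i ≤ n →
          BE n lam lamb kap kapb S' W N E' t0' t1 t2 t3 t4' α β J i) →
        (∀ i, 1 ≤ i → i ≤ n - 2 → S' i = S i) ∧
        (∀ i, 1 ≤ i → i ≤ n - 2 → E' i = E i) ∧
        (∀ i ≤ n, t0' i = t0 i) ∧
        (∀ i ≤ n, t4' i = t4 i) := by
  obtain ⟨m, rfl⟩ := Nat.exists_eq_add_of_le' hn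
  simp only [show m + 4 - 1 = m + 3 from rfl, show m + 4 - 2 = m + 2 from rfl] at *
  have hN1 := hN 1 le_rfl (by omega)
  have hNm := hN (m + 2) (by omega) le_rfl
  have hWm := hW (m + 2) (by omega) le_rfl
  have hkap1 := hkap 1 le_rfl (by omega)
  have hkapb1 := hkapb 1 le_rfl (by omega)
  have hlamp := hlam (m + 3) (by omega) (by omega)
  have hlaml := hlam (m + 4) (by omega) le_rfl
  set t0 : ℕ → F := withEnds m
    ((kap 1 * N 1 * t3 1 + lamb 1 * W 1 * t1 1) / (β * t2 0))
    ((kapb 1 * N 1 * t3 0 + lam 1 * W 1 * t1 0) / (β * t2 1))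
    ((kap (m + 4) * kapb (m + 3) * W (m + 2) * t1 (m + 3)
      + lam (m + 3) * N (m + 2) * t3 (m + 3)) / (β * t2 (m + 3)))
    ((kapb (m + 3) * W (m + 2) * t1 (m + 4)
      + lam (m + 3) * lam (m + 4) * N (m + 2) * t3 (m + 4)) / (β * t2 (m + 4)))
    (fun i => (kapb i * W (i - 1) * N i + lam i * N (i - 1) * W i) / (β * t2 i)) with ht0
  have hβt : ∀ i ≤ m + 4, β * t2 i ≠ 0 := fun i hi => mul_ne_zero hβ (ht2 i hi)
  have ht0mid : ∀ j < m + 1, t0 (j + 2) ≠ 0 := fun j hj => by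
    rw [ht0, withEnds_mid _ _ _ _ _ hj]
    exact div_ne_zero (hgi (j + 2) (by omega) (by omega)) (hβt _ (by omega))
  set a : ℕ → F := fun j => lam (j + 2) * N (j + 1) with ha_def
  set b : ℕ → F := fun j => kap (j + 2) * N (j + 2) with hb_def
  set c : ℕ → F := fun j => -(α * t0 (j + 2) * t1 (j + 2))
  set a' : ℕ → F := fun j => kapb (j + 2) * W (j + 1) with ha'_def
  set b' : ℕ → F := fun j => lamb (j + 2) * W (j + 2) with hb'_def
  set c' : ℕ → F := fun j => α * t0 (j + 2) * t3 (j + 2)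
  have ha : ∀ j < m + 1, a j ≠ 0 := fun j hj =>
    mul_ne_zero (hlam _ (by omega) (by omega)) (hN _ (by omega) (by omega))
  have ha' : ∀ j < m + 1, a' j ≠ 0 := fun j hj =>
    mul_ne_zero (hkapb _ (by omega) (by omega)) (hW _ (by omega) (by omega))
  have hdet : kap (m + 3) * kap (m + 4) * kapb (m + 3) * W (m + 2)
        * (∏ j ∈ Finset.range (m + 1), b j) * (∏ j ∈ Finset.range (m + 1), a' j)
        * (kap 1 * kapb 1 * N 1)
      - lam (m + 3) * lam (m + 4) * lamb (m + 3) * N (m + 2)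
        * (∏ j ∈ Finset.range (m + 1), a j) * (∏ j ∈ Finset.range (m + 1), b' j)
        * (lamb 1 * lam 1 * W 1) ≠ 0 := by
    have hNs := prod_range_shift_mul (fun j => N (j + 1)) (m + 1)
    have hWs := prod_range_shift_mul (fun j => W (j + 1)) (m + 1)
    have hl' : l = lam 1 * (∏ j ∈ Finset.range (m + 1), lam (j + 2)) * lam (m + 3) * lam (m + 4)
        * (lamb 1 * (∏ j ∈ Finset.range (m + 1), lamb (j + 2)) * lamb (m + 3)) := by
      rw [hl, Finset.prod_Icc_succ_top (by omega), prod_Icc_one_add_two, prod_Icc_one_add_two]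
    have hk' : k = kap 1 * (∏ j ∈ Finset.range (m + 1), kap (j + 2)) * kap (m + 3) * kap (m + 4)
        * (kapb 1 * (∏ j ∈ Finset.range (m + 1), kapb (j + 2)) * kapb (m + 3)) := by
      rw [hk, Finset.prod_Icc_succ_top (by omega), prod_Icc_one_add_two, prod_Icc_one_add_two]
    have hNp : (∏ j ∈ Finset.range (m + 1), N (j + 1)) ≠ 0 := Finset.prod_ne_zero_iff.2
      fun j hj => hN _ (by omega) (by have := Finset.mem_range.1 hj; omega)
    have hWp : (∏ j ∈ Finset.range (m + 1), W (j + 1)) ≠ 0 := Finset.prod_ne_zero_iff.2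
      fun j hj => hW _ (by omega) (by have := Finset.mem_range.1 hj; omega)
    have hkl : k - l ≠ 0 := by
      rw [← neg_sub]
      exact neg_ne_zero.2 (right_ne_zero_of_mul hlk)
    convert mul_ne_zero (mul_ne_zero (mul_ne_zero hNm hWm) (mul_ne_zero hNp hWp)) hkl using 1
    simp only [ha_def, hb_def, ha'_def, hb'_def, Finset.prod_mul_distrib]
    simp only [zero_add, add_assoc, Nat.reduceAdd] at hNs hWs
    rw [hl', hk']
    generalize (∏ j ∈ Finset.range (m + 1), N (j + 1)) = Np at *
    generalize (∏ j ∈ Finset.range (m + 1), W (j + 1)) = Wp at *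
    generalize (∏ j ∈ Finset.range (m + 1), N (j + 2)) = Nq at *
    generalize (∏ j ∈ Finset.range (m + 1), W (j + 2)) = Wq at *
    generalize (∏ j ∈ Finset.range (m + 1), lam (j + 2)) = L at *
    generalize (∏ j ∈ Finset.range (m + 1), lamb (j + 2)) = Lb at *
    generalize (∏ j ∈ Finset.range (m + 1), kap (j + 2)) = K at *
    generalize (∏ j ∈ Finset.range (m + 1), kapb (j + 2)) = Kb at *
    linear_combination kap (m + 3) * kap (m + 4) * kapb (m + 3) * W (m + 2) * K * Kb * Wp
        * kap 1 * kapb 1 * hNs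
      - lam (m + 3) * lam (m + 4) * lamb (m + 3) * N (m + 2) * L * Np * Lb * lamb 1 * lam 1 * hWs
  obtain ⟨x₀, y₀, hxy⟩ := exists_unique_linRec_initial (c := c) (c' := c')
    (r := α * β * t0 0 * t0 1) (d := α * β * t0 (m + 3) * t0 (m + 4)) ha ha' hdet
  obtain ⟨hfirst, hlast⟩ := (hxy x₀ y₀).2 ⟨rfl, rfl⟩
  set E : ℕ → F := fun i => linRec a b c x₀ (i - 1)
  set S : ℕ → F := fun i => linRec a' b' c' y₀ (i - 1)
  set t4 : ℕ → F := withEnds m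
    ((lam 1 * E 1 * t2 0 + α * t0 1 * t1 1) / (kap 1 * N 1))
    ((lamb 1 * E 1 * t2 1 + α * t0 0 * t1 0) / (kapb 1 * N 1))
    ((kap (m + 3) * E (m + 2) * t2 (m + 3) - α * t0 (m + 4) * t1 (m + 3))
      / (lam (m + 3) * N (m + 2)))
    ((kap (m + 3) * kap (m + 4) * E (m + 2) * t2 (m + 4) - α * t0 (m + 3) * t1 (m + 4))
      / (lam (m + 3) * lam (m + 4) * N (m + 2)))
    (fun i => (kap i * E (i - 1) * S i + lamb i * S (i - 1) * E i) / (β * t0 i)) with ht4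
  have hred : ReducedSystem m lam lamb kap kapb S W N E t0 t1 t2 t3 t4 α β := by
    have h20 := ht2 0 (by omega)
    have h21 := ht2 1 (by omega)
    have h2p := ht2 (m + 3) (by omega)
    have h2l := ht2 (m + 4) le_rfl
    refine ⟨?_, ?_, fun j hj => ?_, ?_, ?_, ?_, ?_, ?_, ?_, fun j hj => ?_, fun j hj => ?_,
      fun j hj => ?_, hfirst, hlast⟩
    · rw [ht0, withEnds_zero]; field_simp
    · rw [ht0, withEnds_one]; field_simp
    · have := ht2 (j + 2) (by omega)
      rw [ht0, withEnds_mid _ _ _ _ _ hj, show j + 2 - 1 = j + 1 from rfl]; field_simp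
    · rw [ht0, withEnds_penult]; field_simp
    · rw [ht0, withEnds_last]; field_simp
    · rw [ht4, withEnds_one]; field_simp; ring
    · rw [ht4, withEnds_zero]; field_simp; ring
    · rw [ht4, withEnds_last]; field_simp; ring
    · rw [ht4, withEnds_penult]; field_simp; ring
    · have := ht0mid j hj
      rw [ht4, withEnds_mid _ _ _ _ _ hj, show j + 2 - 1 = j + 1 from rfl]; field_simp
    · exact linRec_succ a b c x₀ (ha j hj)
    · exact linRec_succ a' b' c' y₀ (ha' j hj)
  refine ⟨S, E, t0, t4, hred.toBE hlam hkap hkapb hN ht2, fun S' E' t0' t4' hBE => ?_⟩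
  have h' := ReducedSystem.of_BE ht2 hBE
  have et0 : ∀ i ≤ m + 4, t0' i = t0 i := by
    refine eq_of_ends ?_ ?_ ?_ ?_ fun j hj => ?_
    · apply mul_left_cancel₀ (hβt 0 (by omega))
      linear_combination hred.tau0_zero - h'.tau0_zero
    · apply mul_left_cancel₀ (hβt 1 (by omega))
      linear_combination hred.tau0_one - h'.tau0_one
    · apply mul_left_cancel₀ (hβt (m + 3) (by omega))
      linear_combination hred.tau0_penult - h'.tau0_penult
    · apply mul_left_cancel₀ (hβt (m + 4) le_rfl)
      linear_combination hred.tau0_last - h'.tau0_last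
    · apply mul_left_cancel₀ (hβt (j + 2) (by omega))
      linear_combination hred.tau0_mid j hj - h'.tau0_mid j hj
  have e0 := et0 0 (by omega)
  have e1 := et0 1 (by omega)
  have ep := et0 (m + 3) (by omega)
  have el := et0 (m + 4) le_rfl
  have eE : ∀ j ≤ m + 1, E' (j + 1) = linRec a b c (E' 1) j := fun j hj =>
    eq_linRec (u := fun j => E' (j + 1)) ha
      (fun i hi => (h'.east i hi).trans (by rw [et0 (i + 2) (by omega)])) hj
  have eS : ∀ j ≤ m + 1, S' (j + 1) = linRec a' b' c' (S' 1) j := fun j hj =>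
    eq_linRec (u := fun j => S' (j + 1)) ha'
      (fun i hi => (h'.south i hi).trans (by rw [et0 (i + 2) (by omega)])) hj
  obtain ⟨hx, hy⟩ := (hxy (E' 1) (S' 1)).1
    ⟨by rw [← e0, ← e1]; exact h'.first_end,
      by rw [← eE _ le_rfl, ← eS _ le_rfl, ← ep, ← el]; exact h'.last_end⟩
  have eE' : ∀ i, 1 ≤ i → i ≤ m + 2 → E' i = E i := fun i h1 h2 => by
    obtain ⟨j, rfl⟩ := Nat.exists_eq_add_of_le' h1
    rw [eE j (by omega), hx]; rfl
  have eS' : ∀ i, 1 ≤ i → i ≤ m + 2 → S' i = S i := fun i h1 h2 => by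
    obtain ⟨j, rfl⟩ := Nat.exists_eq_add_of_le' h1
    rw [eS j (by omega), hy]; rfl
  have eE1 := eE' 1 le_rfl (by omega)
  have eEm := eE' (m + 2) (by omega) le_rfl
  refine ⟨eS', eE', et0, eq_of_ends ?_ ?_ ?_ ?_ fun j hj => ?_⟩
  · have := h'.tau4_zero
    rw [eE1, e1] at this
    apply mul_left_cancel₀ (mul_ne_zero hkap1 hN1)
    linear_combination this - hred.tau4_zero
  · have := h'.tau4_one
    rw [eE1, e0] at this
    apply mul_left_cancel₀ (mul_ne_zero hkapb1 hN1)
    linear_combination this - hred.tau4_one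
  · have := h'.tau4_penult
    rw [eEm, el] at this
    apply mul_left_cancel₀ (mul_ne_zero hlamp hNm)
    linear_combination hred.tau4_penult - this
  · have := h'.tau4_last
    rw [eEm, ep] at this
    apply mul_left_cancel₀ (mul_ne_zero (mul_ne_zero hlamp hlaml) hNm)
    linear_combination hred.tau4_last - this
  · have := h'.tau4_mid j hj
    rw [eE' (j + 1) (by omega) (by omega), eE' (j + 2) (by omega) (by omega),
      eS' (j + 1) (by omega) (by omega), eS' (j + 2) (by omega) (by omega),
      et0 (j + 2) (by omega)] at this
    apply mul_left_cancel₀ (mul_ne_zero hβ (ht0mid j hj))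
    linear_combination hred.tau4_mid j hj - this
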